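/- Nonnegativity of conditional mutual information: Let 𝔛₁, 𝔛₂, 𝔜 be pairwise compatible unital *-subalgebras of M_n(ℂ) and ρ a state on M_n(ℂ). Then I_ρ(𝔛₁∧𝔛₂|𝔜) ≥ 0. -/

import Mathlib

open scoped ComplexOrder Kronecker
open Matrix

noncomputable def negMulLogb (x : ℝ) : ℝ := -(x * Real.logb 2 x)

noncomputable def shannonEntropy {α : Type*} [Fintype α] (p : α → ℝ) : ℝ :=
  ∑ i, negMulLogb (p i)

noncomputable def mutualInfo {α β : Type*} [Fintype α] [Fintype β]
    (p : α → β → ℝ) : ℝ :=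
  shannonEntropy (fun i => ∑ j, p i j) + shannonEntropy (fun j => ∑ i, p i j)
    - shannonEntropy (fun ij : α × β => p ij.1 ij.2)

noncomputable def binEnt (t : ℝ) : ℝ := negMulLogb t + negMulLogb (1 - t)

noncomputable def vnEntropy {α : Type*} [Fintype α] [DecidableEq α]
    (ρ : Matrix α α ℂ) : ℝ :=
  if h : ρ.IsHermitian then ∑ i, negMulLogb (h.eigenvalues i) else 0

noncomputable def matLogb {α : Type*} [Fintype α] [DecidableEq α]
    (A : Matrix α α ℂ) : Matrix α α ℂ :=
  if h : A.IsHermitian then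
    (h.eigenvectorUnitary : Matrix α α ℂ) *
      Matrix.diagonal (fun i => (Real.logb 2 (h.eigenvalues i) : ℂ)) *
      star (h.eigenvectorUnitary : Matrix α α ℂ)
  else 0

def MatState {α : Type*} [Fintype α] [DecidableEq α] (ρ : Matrix α α ℂ) : Prop :=
  ρ.PosSemidef ∧ ρ.trace = 1

def IsProjn {α : Type*} [Fintype α] [DecidableEq α] (p : Matrix α α ℂ) : Prop :=
  p.IsHermitian ∧ p * p = p

def IsMinProjOf {α : Type*} [Fintype α] [DecidableEq α]
    (X : StarSubalgebra ℂ (Matrix α α ℂ)) (p : Matrix α α ℂ) : Prop :=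
  p ∈ X ∧ IsProjn p ∧ p ≠ 0 ∧
    ∀ q ∈ X, IsProjn q → q * p = q → q = 0 ∨ q = p

def IsCanonicalTrace {α : Type*} [Fintype α] [DecidableEq α]
    (X : StarSubalgebra ℂ (Matrix α α ℂ)) (τ : Matrix α α ℂ →ₗ[ℂ] ℂ) : Prop :=
  (∀ x ∈ X, ∀ y ∈ X, τ (x * y) = τ (y * x)) ∧
  (∀ x ∈ X, 0 ≤ τ (star x * x)) ∧
  (∀ p, IsMinProjOf X p → τ p = 1)

def IsRestriction {α : Type*} [Fintype α] [DecidableEq α]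
    (X : StarSubalgebra ℂ (Matrix α α ℂ)) (τ : Matrix α α ℂ →ₗ[ℂ] ℂ)
    (ρ r : Matrix α α ℂ) : Prop :=
  r ∈ X ∧ r.PosSemidef ∧ ∀ x ∈ X, τ (r * x) = (ρ * x).trace

noncomputable def algEntropy {α : Type*} [Fintype α] [DecidableEq α]
    (τ : Matrix α α ℂ →ₗ[ℂ] ℂ) (r : Matrix α α ℂ) : ℝ :=
  -(τ (r * matLogb r)).re

def IsAlgEntropy {α : Type*} [Fintype α] [DecidableEq α]
    (X : StarSubalgebra ℂ (Matrix α α ℂ)) (ρ : Matrix α α ℂ) (H : ℝ) : Prop :=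
  ∃ τ r, IsCanonicalTrace X τ ∧ IsRestriction X τ ρ r ∧ H = algEntropy τ r

def CompatibleAlg {α : Type*} [Fintype α] [DecidableEq α]
    (X Y : StarSubalgebra ℂ (Matrix α α ℂ)) : Prop :=
  ∀ x ∈ X, ∀ y ∈ Y, x * y = y * x

/-- A finite family of pairwise orthogonal projections with sum `p`. -/
structure IsOrthoSum {α ι : Type*} [Fintype α] [DecidableEq α] [Fintype ι]
    (P : ι → Matrix α α ℂ) (p : Matrix α α ℂ) : Prop where
  projn : ∀ i, IsProjn (P i)
  ortho : ∀ i j, i ≠ j → P i * P j = 0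
  sum_eq : ∑ i, P i = p

section Resolution

variable {α ι : Type*} [Fintype α] [DecidableEq α] [Fintype ι]

theorem IsProjn.star_eq {p : Matrix α α ℂ} (hp : IsProjn p) : star p = p := hp.1

theorem IsOrthoSum.mul_sum_smul {P : ι → Matrix α α ℂ} {p : Matrix α α ℂ}
    (hP : IsOrthoSum P p) (c : ι → ℂ) (i : ι) :
    P i * (∑ j, c j • P j) = c i • P i := by
  rw [Finset.mul_sum, Finset.sum_eq_single i]
  · rw [mul_smul_comm, (hP.projn i).2]
  · intro j _ hj
    rw [mul_smul_comm, hP.ortho i j hj.symm, smul_zero]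
  · simp

theorem IsOrthoSum.sum_smul_mul {P : ι → Matrix α α ℂ} {p : Matrix α α ℂ}
    (hP : IsOrthoSum P p) (c : ι → ℂ) (i : ι) :
    (∑ j, c j • P j) * P i = c i • P i := by
  rw [Finset.sum_mul, Finset.sum_eq_single i]
  · rw [smul_mul_assoc, (hP.projn i).2]
  · intro j _ hj
    rw [smul_mul_assoc, hP.ortho j i hj, smul_zero]
  · simp

theorem IsOrthoSum.mul_left_self {P : ι → Matrix α α ℂ} {p : Matrix α α ℂ}
    (hP : IsOrthoSum P p) (i : ι) : p * P i = P i := by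
  have := hP.sum_smul_mul (fun _ => 1) i
  simpa [hP.sum_eq] using this

theorem IsOrthoSum.mul_right_self {P : ι → Matrix α α ℂ} {p : Matrix α α ℂ}
    (hP : IsOrthoSum P p) (i : ι) : P i * p = P i := by
  have := hP.mul_sum_smul (fun _ => 1) i
  simpa [hP.sum_eq] using this

theorem aeval_mul_of_mul_eq_smul {A p : Matrix α α ℂ} {c : ℂ} (h : A * p = c • p)
    (f : Polynomial ℂ) : Polynomial.aeval A f * p = f.eval c • p := by
  induction f using Polynomial.induction_on' with
  | add f g hf hg => simp [add_mul, hf, hg, add_smul]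
  | monomial k a =>
    have hk : A ^ k * p = c ^ k • p := by
      induction k with
      | zero => simp
      | succ k ih => rw [pow_succ, mul_assoc, h, mul_smul_comm, ih, smul_smul, pow_succ, mul_comm]
    rw [Polynomial.aeval_monomial, Polynomial.eval_monomial, mul_assoc, hk,
      Algebra.algebraMap_eq_smul_one, smul_mul_assoc, one_mul, smul_smul]

theorem IsOrthoSum.aeval_eq {P : ι → Matrix α α ℂ} (hP : IsOrthoSum P 1)
    (c : ι → ℂ) (f : Polynomial ℂ) :
    Polynomial.aeval (∑ i, c i • P i) f = ∑ i, f.eval (c i) • P i := by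
  rw [← mul_one (Polynomial.aeval _ f), ← hP.sum_eq, Finset.mul_sum]
  refine Finset.sum_congr rfl fun i _ => ?_
  exact aeval_mul_of_mul_eq_smul (by rw [hP.sum_smul_mul]) f

theorem exists_polynomial_eval_eq (s : Finset ℂ) (g : ℂ → ℂ) :
    ∃ f : Polynomial ℂ, ∀ x ∈ s, f.eval x = g x :=
  ⟨Lagrange.interpolate s id g, fun _ hx =>
    Lagrange.eval_interpolate_at_node (v := id) g (Set.injOn_id _) hx⟩

/-- Rank-one spectral projections of a Hermitian matrix. -/
noncomputable def eigenProj {A : Matrix α α ℂ} (h : A.IsHermitian) (k : α) : Matrix α α ℂ :=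
  (h.eigenvectorUnitary : Matrix α α ℂ) * Matrix.diagonal (Pi.single k 1) *
    star (h.eigenvectorUnitary : Matrix α α ℂ)

theorem sum_smul_eigenProj {A : Matrix α α ℂ} (h : A.IsHermitian) (c : α → ℂ) :
    ∑ k, c k • eigenProj h k = (h.eigenvectorUnitary : Matrix α α ℂ) * Matrix.diagonal c *
      star (h.eigenvectorUnitary : Matrix α α ℂ) := by
  have hc : Matrix.diagonal c = ∑ k, c k • Matrix.diagonal (Pi.single k (1 : ℂ)) := by
    ext i j
    simp only [Matrix.sum_apply, Matrix.smul_apply, Matrix.diagonal_apply]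
    by_cases hij : i = j
    · subst hij
      simp [Pi.single_apply]
    · simp [hij]
  rw [hc, Finset.mul_sum, Finset.sum_mul]
  simp [eigenProj]

theorem eigenProj_isOrthoSum {A : Matrix α α ℂ} (h : A.IsHermitian) :
    IsOrthoSum (eigenProj h) 1 := by
  have hU : star (h.eigenvectorUnitary : Matrix α α ℂ) * (h.eigenvectorUnitary : Matrix α α ℂ) = 1 :=
    Unitary.coe_star_mul_self _
  have hU' : (h.eigenvectorUnitary : Matrix α α ℂ) * star (h.eigenvectorUnitary : Matrix α α ℂ) = 1 :=
    Unitary.coe_mul_star_self _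
  have hmul : ∀ i j, eigenProj h i * eigenProj h j =
      (h.eigenvectorUnitary : Matrix α α ℂ) *
        Matrix.diagonal (fun k => (Pi.single i 1 : α → ℂ) k * (Pi.single j 1 : α → ℂ) k) *
        star (h.eigenvectorUnitary : Matrix α α ℂ) := by
    intro i j
    rw [← Matrix.diagonal_mul_diagonal]
    simp only [eigenProj, mul_assoc]
    rw [← mul_assoc (star _) (h.eigenvectorUnitary : Matrix α α ℂ), hU, one_mul]
  refine ⟨fun i => ⟨?_, ?_⟩, fun i j hij => ?_, ?_⟩
  · change star (eigenProj h i) = eigenProj h i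
    have : star (Matrix.diagonal (Pi.single i (1 : ℂ))) = Matrix.diagonal (Pi.single i (1 : ℂ)) := by
      rw [Matrix.star_eq_conjTranspose, Matrix.diagonal_conjTranspose]
      congr 1
      ext k
      by_cases hk : k = i <;> simp [hk]
    simp only [eigenProj, star_mul, star_star, this, mul_assoc]
  · rw [hmul, eigenProj]
    congr 3
    ext k
    by_cases hk : k = i <;> simp [hk]
  · have : (fun k => (Pi.single i 1 : α → ℂ) k * (Pi.single j 1 : α → ℂ) k) = 0 := by
      ext k
      by_cases hk : k = i
      · subst hk
        simp [hij]
      · simp [Pi.single_apply, hk]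
    rw [hmul, this]
    simp
  · have := sum_smul_eigenProj h (fun _ => 1)
    simp only [one_smul, Matrix.diagonal_one, mul_one, hU'] at this
    exact this

theorem sum_eigenvalues_smul_eigenProj {A : Matrix α α ℂ} (h : A.IsHermitian) :
    ∑ k, (h.eigenvalues k : ℂ) • eigenProj h k = A := by
  rw [sum_smul_eigenProj]
  conv_rhs => rw [h.spectral_theorem]
  rw [Unitary.conjStarAlgAut_apply]
  rfl

/-- `matLogb` can be computed from any orthogonal diagonalization. -/
theorem IsOrthoSum.matLogb_eq {P : ι → Matrix α α ℂ} (hP : IsOrthoSum P 1) (a : ι → ℝ) :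
    matLogb (∑ i, (a i : ℂ) • P i) = ∑ i, (Real.logb 2 (a i) : ℂ) • P i := by
  have h : (∑ i, (a i : ℂ) • P i).IsHermitian := by
    change star (∑ i, (a i : ℂ) • P i) = _
    rw [star_sum]
    refine Finset.sum_congr rfl fun i _ => ?_
    rw [star_smul, (hP.projn i).star_eq]
    simp
  obtain ⟨f, hf⟩ := exists_polynomial_eval_eq
    (Finset.univ.image (fun i => (a i : ℂ)) ∪ Finset.univ.image (fun i => (h.eigenvalues i : ℂ)))
    (fun z => (Real.logb 2 z.re : ℂ))
  rw [matLogb, dif_pos h, ← sum_smul_eigenProj]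
  trans Polynomial.aeval (∑ i, (a i : ℂ) • P i) f
  · conv_rhs => rw [← sum_eigenvalues_smul_eigenProj h]
    rw [(eigenProj_isOrthoSum h).aeval_eq]
    refine Finset.sum_congr rfl fun k _ => ?_
    rw [hf _ (by simp)]
    simp
  · rw [hP.aeval_eq]
    refine Finset.sum_congr rfl fun k _ => ?_
    rw [hf _ (by simp)]
    simp

end Resolution

section MinProj

variable {α : Type*} [Fintype α] [DecidableEq α]

theorem StarSubalgebra.aeval_mem_of_mem {X : StarSubalgebra ℂ (Matrix α α ℂ)} {A : Matrix α α ℂ}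
    (hA : A ∈ X) (f : Polynomial ℂ) : Polynomial.aeval A f ∈ X :=
  Algebra.adjoin_le (S := X.toSubalgebra) (Set.singleton_subset_iff.mpr hA)
    (Polynomial.aeval_mem_adjoin_singleton ℂ A)

theorem exists_spectral_projn {X : StarSubalgebra ℂ (Matrix α α ℂ)} {h : Matrix α α ℂ}
    (hX : h ∈ X) (hh : h.IsHermitian) (h0 : h ≠ 0) :
    ∃ (μ : ℝ) (q : Matrix α α ℂ), μ ≠ 0 ∧ q ∈ X ∧ IsProjn q ∧ q ≠ 0 ∧
      h * q = (μ : ℂ) • q ∧ ∀ z, Commute h z → Commute q z := by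
  have hR := eigenProj_isOrthoSum hh
  have hA := sum_eigenvalues_smul_eigenProj hh
  obtain ⟨k, hk, hk0⟩ : ∃ k, hh.eigenvalues k ≠ 0 ∧ eigenProj hh k ≠ 0 := by
    by_contra! hcon
    apply h0
    rw [← hA]
    refine Finset.sum_eq_zero fun k _ => ?_
    by_cases hk : hh.eigenvalues k = 0
    · simp [hk]
    · simp [hcon k hk]
  obtain ⟨f, hf⟩ := exists_polynomial_eval_eq
    (Finset.univ.image (fun i => (hh.eigenvalues i : ℂ)))
    (fun z => if z = (hh.eigenvalues k : ℂ) then 1 else 0)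
  have hq : Polynomial.aeval h f =
      ∑ i, (if hh.eigenvalues i = hh.eigenvalues k then (1 : ℂ) else 0) • eigenProj hh i := by
    conv_lhs => rw [← hA]
    rw [hR.aeval_eq]
    refine Finset.sum_congr rfl fun i _ => ?_
    rw [hf _ (by simp)]
    simp
  refine ⟨hh.eigenvalues k, Polynomial.aeval h f, hk, X.aeval_mem_of_mem hX f, ⟨?_, ?_⟩, ?_, ?_, ?_⟩
  · rw [hq]
    change star (∑ i, _) = _
    rw [star_sum]
    refine Finset.sum_congr rfl fun i _ => ?_
    rw [star_smul, (hR.projn i).star_eq]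
    split_ifs <;> simp
  · rw [hq, Finset.sum_mul]
    refine Finset.sum_congr rfl fun i _ => ?_
    rw [smul_mul_assoc, hR.mul_sum_smul, smul_smul]
    split_ifs <;> simp
  · intro h1
    apply hk0
    have := hR.sum_smul_mul
      (fun i => if hh.eigenvalues i = hh.eigenvalues k then (1 : ℂ) else 0) k
    rw [← hq, h1] at this
    simpa using this.symm
  · rw [hq, Finset.mul_sum, Finset.smul_sum]
    refine Finset.sum_congr rfl fun i _ => ?_
    have := hR.sum_smul_mul (fun k => (hh.eigenvalues k : ℂ)) i
    rw [hA] at this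
    rw [mul_smul_comm, this]
    split_ifs with h2
    · simp [h2]
    · simp
  · intro z hz
    exact Algebra.commute_of_mem_adjoin_singleton_of_commute
      (Polynomial.aeval_mem_adjoin_singleton ℂ h) hz.symm |>.symm


theorem IsProjn.posSemidef {p : Matrix α α ℂ} (hp : IsProjn p) : p.PosSemidef := by
  have := Matrix.posSemidef_conjTranspose_mul_self p
  rwa [hp.1.eq, hp.2] at this

theorem IsProjn.trace_pos {p : Matrix α α ℂ} (hp : IsProjn p) (h0 : p ≠ 0) : 0 < p.trace :=
  lt_of_le_of_ne hp.posSemidef.trace_nonneg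
    fun h => h0 (hp.posSemidef.trace_eq_zero_iff.mp h.symm)

theorem nonneg_of_posSemidef_smul {p : Matrix α α ℂ} (hp : IsProjn p) (h0 : p ≠ 0) {c : ℂ}
    (hc : (c • p).PosSemidef) : 0 ≤ c := by
  have h1 := hc.trace_nonneg
  rw [Matrix.trace_smul, smul_eq_mul] at h1
  obtain ⟨hre, him⟩ := Complex.pos_iff.mp (hp.trace_pos h0)
  rw [Complex.nonneg_iff, Complex.mul_re, Complex.mul_im, ← him] at h1
  rw [Complex.nonneg_iff]
  constructor
  · by_contra! hneg
    nlinarith [h1.1]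
  · have := h1.2
    simp only [mul_zero, zero_add, zero_eq_mul] at this
    exact (this.resolve_right hre.ne').symm

theorem IsProjn.mul_eq_of_mul_eq {p q : Matrix α α ℂ} (hp : IsProjn p) (hq : IsProjn q)
    (h : q * p = q) : p * q = q := by
  have := congrArg star h
  rwa [star_mul, hp.star_eq, hq.star_eq] at this

theorem IsProjn.sub {p q : Matrix α α ℂ} (hp : IsProjn p) (hq : IsProjn q)
    (h : q * p = q) : IsProjn (p - q) := by
  refine ⟨hp.1.sub hq.1, ?_⟩
  rw [mul_sub, sub_mul, sub_mul, hp.2, hq.2, h, hp.mul_eq_of_mul_eq hq h]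
  abel

theorem rank_lt_of_isProjn {p q : Matrix α α ℂ} (hq : IsProjn q) (h : p * q = q) (h' : q * p = q) (hne : q ≠ p) :
    q.rank < p.rank := by
  refine lt_of_le_of_ne ?_ fun heq => hne ?_
  · rw [← h]
    exact Matrix.rank_mul_le_left p q
  · have hle : LinearMap.range q.mulVecLin ≤ LinearMap.range p.mulVecLin := by
      conv_lhs => rw [← h, Matrix.mulVecLin_mul]
      exact LinearMap.range_comp_le_range _ _
    have hr : LinearMap.range q.mulVecLin = LinearMap.range p.mulVecLin :=
      Submodule.eq_of_le_of_finrank_eq hle heq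
    have hqp : q * p = p := by
      refine Matrix.ext_of_mulVec_single fun i => ?_
      obtain ⟨w, hw⟩ : p *ᵥ Pi.single i 1 ∈ LinearMap.range q.mulVecLin :=
        hr ▸ ⟨Pi.single i 1, rfl⟩
      have hw' : q *ᵥ w = p *ᵥ Pi.single i 1 := hw
      rw [← Matrix.mulVec_mulVec, ← hw', Matrix.mulVec_mulVec, hq.2]
    rw [← h', hqp]

/-- A projection cut by a commuting Hermitian element splits into minimal projections. -/
theorem exists_minProj_decomposition_of_commute {X : StarSubalgebra ℂ (Matrix α α ℂ)}
    {r : Matrix α α ℂ} (hrX : r ∈ X) (hr : r.IsHermitian) (k : ℕ) :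
    ∀ p ∈ X, IsProjn p → Commute p r → p.rank ≤ k →
    ∃ (ι : Type) (_ : Fintype ι) (P : ι → Matrix α α ℂ) (a : ι → ℝ),
      (∀ i, IsMinProjOf X (P i)) ∧ IsOrthoSum P p ∧ r * p = ∑ i, (a i : ℂ) • P i := by
  induction k using Nat.strong_induction_on with
  | _ k ih =>
  intro p hpX hp hpr hk
  by_cases h0 : p = 0
  · subst h0
    exact ⟨Empty, inferInstance, Empty.elim, Empty.elim, fun i => i.elim,
      ⟨fun i => i.elim, fun i => i.elim, by simp⟩, by simp⟩
  by_cases hex : ∃ q ∈ X, IsProjn q ∧ q * p = q ∧ q ≠ 0 ∧ q ≠ p ∧ Commute q r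
  · obtain ⟨q, hqX, hq, hqp, hq0, hqne, hqr⟩ := hex
    have hpq := hp.mul_eq_of_mul_eq hq hqp
    have hs := hp.sub hq hqp
    obtain ⟨ι, _, P, a, hP, hPs, hPr⟩ :=
      ih q.rank ((rank_lt_of_isProjn hq hpq hqp hqne).trans_le hk) q hqX hq hqr le_rfl
    obtain ⟨κ, _, Q, b, hQ, hQs, hQr⟩ :=
      ih (p - q).rank
        ((rank_lt_of_isProjn hs (p := p) (by rw [mul_sub, hp.2, hpq]) (by rw [sub_mul, hp.2, hqp])
          (by simpa using hq0)).trans_le hk)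
        (p - q) (sub_mem hpX hqX) hs (hpr.sub_left hqr) le_rfl
    have hq' : q * (p - q) = 0 := by rw [mul_sub, hqp, hq.2, sub_self]
    have hq'' : (p - q) * q = 0 := by rw [sub_mul, hpq, hq.2, sub_self]
    refine ⟨ι ⊕ κ, inferInstance, Sum.elim P Q, Sum.elim a b, ?_, ⟨?_, ?_, ?_⟩, ?_⟩
    · rintro (i | i)
      exacts [hP i, hQ i]
    · rintro (i | i)
      exacts [(hP i).2.1, (hQ i).2.1]
    · rintro (i | i) (j | j) hij
      · exact hPs.ortho i j (by simpa using hij)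
      · change P i * Q j = 0
        rw [← hPs.mul_right_self i, ← hQs.mul_left_self j, mul_assoc, ← mul_assoc q, hq',
          zero_mul, mul_zero]
      · change Q i * P j = 0
        rw [← hQs.mul_right_self i, ← hPs.mul_left_self j, mul_assoc, ← mul_assoc (p - q), hq'',
          zero_mul, mul_zero]
      · exact hQs.ortho i j (by simpa using hij)
    · simp [hPs.sum_eq, hQs.sum_eq]
    · simp only [Fintype.sum_sum_type, Sum.elim_inl, Sum.elim_inr]
      rw [← hPr, ← hQr, ← mul_add, add_sub_cancel]
  · push Not at hex
    obtain ⟨c, hc⟩ : ∃ c : ℝ, r * p = (c : ℂ) • p := by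
      by_cases hrp : r * p = 0
      · exact ⟨0, by simp [hrp]⟩
      have hh : (r * p).IsHermitian := by
        change star (r * p) = r * p
        rw [star_mul, hp.star_eq, show star r = r from hr, hpr.eq]
      obtain ⟨μ, q, hμ, hqX, hq, hq0, hhq, hcomm⟩ :=
        exists_spectral_projn (mul_mem hrX hpX) hh hrp
      have hpq : p * q = q := by
        have h1 : p * ((r * p) * q) = (r * p) * q := by
          rw [← mul_assoc, ← mul_assoc, hpr.eq, mul_assoc r, hp.2]
        rw [hhq, mul_smul_comm] at h1
        exact smul_right_injective _ (Complex.ofReal_ne_zero.mpr hμ) h1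
      have hqp : q * p = q := by
        have := congrArg star hpq
        rwa [star_mul, hp.star_eq, hq.star_eq] at this
      have hqr : Commute q r := hcomm r (by
        change r * p * r = r * (r * p)
        rw [mul_assoc, hpr.eq])
      have : q = p := by
        by_contra hne
        exact hex q hqX hq hqp hq0 hne hqr
      subst this
      refine ⟨μ, ?_⟩
      rw [mul_assoc, hq.2] at hhq
      exact hhq
    refine ⟨Unit, inferInstance, fun _ => p, fun _ => c, fun _ => ⟨hpX, hp, h0, ?_⟩,
      ⟨fun _ => hp, fun i j h => (h rfl).elim, by simp⟩, by simp [hc]⟩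
    intro q hqX hq hqp
    by_contra! hcon
    refine hex q hqX hq hqp hcon.1 hcon.2 ?_
    have hpq := hp.mul_eq_of_mul_eq hq hqp
    change q * r = r * q
    calc q * r = q * (p * r) := by rw [← mul_assoc, hqp]
      _ = (c : ℂ) • q := by rw [hpr.eq, hc, mul_smul_comm, hqp]
      _ = r * p * q := by rw [hc, smul_mul_assoc, hpq]
      _ = r * q := by rw [mul_assoc, hpq]

/-- Diagonalization of a Hermitian element of `X` by minimal projections of `X`. -/
theorem exists_minProj_decomposition {X : StarSubalgebra ℂ (Matrix α α ℂ)}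
    {r : Matrix α α ℂ} (hrX : r ∈ X) (hr : r.IsHermitian) :
    ∃ (ι : Type) (_ : Fintype ι) (P : ι → Matrix α α ℂ) (a : ι → ℝ),
      (∀ i, IsMinProjOf X (P i)) ∧ IsOrthoSum P 1 ∧ r = ∑ i, (a i : ℂ) • P i := by
  obtain ⟨ι, i, P, a, hP, hs, h⟩ := exists_minProj_decomposition_of_commute hrX hr _ 1 (one_mem X)
    ⟨Matrix.isHermitian_one, one_mul 1⟩ (Commute.one_left r) le_rfl
  exact ⟨ι, i, P, a, hP, hs, by simpa using h⟩

theorem IsOrthoSum.nonneg_of_posSemidef {ι : Type*} [Fintype ι] {P : ι → Matrix α α ℂ}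
    {p : Matrix α α ℂ} (hP : IsOrthoSum P p) {a : ι → ℝ}
    (h : (∑ i, (a i : ℂ) • P i).PosSemidef) (i : ι) (h0 : P i ≠ 0) : 0 ≤ a i := by
  have h1 := h.conjTranspose_mul_mul_same (P i)
  rw [(hP.projn i).1.eq, hP.mul_sum_smul, smul_mul_assoc, (hP.projn i).2] at h1
  exact_mod_cast nonneg_of_posSemidef_smul (hP.projn i) h0 h1

theorem IsMinProjOf.exists_compress_of_isHermitian {X : StarSubalgebra ℂ (Matrix α α ℂ)}
    {p : Matrix α α ℂ} (hp : IsMinProjOf X p) {x : Matrix α α ℂ} (hx : x ∈ X)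
    (hh : x.IsHermitian) : ∃ c : ℂ, p * x * p = c • p := by
  obtain ⟨hpX, hpp, h0, hmin⟩ := hp
  by_cases hz : p * x * p = 0
  · exact ⟨0, by simp [hz]⟩
  have hherm : (p * x * p).IsHermitian := by
    change star (p * x * p) = _
    rw [star_mul, star_mul, hpp.star_eq, show star x = x from hh, mul_assoc]
  obtain ⟨μ, q, hμ, hqX, hq, hq0, hhq, -⟩ :=
    exists_spectral_projn (mul_mem (mul_mem hpX hx) hpX) hherm hz
  have hpq : p * q = q := by
    have h1 : p * ((p * x * p) * q) = (p * x * p) * q := by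
      simp only [← mul_assoc, hpp.2]
    rw [hhq, mul_smul_comm] at h1
    exact smul_right_injective _ (Complex.ofReal_ne_zero.mpr hμ) h1
  have hqp : q * p = q := by
    have := congrArg star hpq
    rwa [star_mul, hpp.star_eq, hq.star_eq] at this
  obtain h | h := hmin q hqX hq hqp
  · exact absurd h hq0
  · subst h
    refine ⟨μ, ?_⟩
    rw [mul_assoc, hpp.2] at hhq
    exact hhq

/-- The corner of a minimal projection is one-dimensional. -/
theorem IsMinProjOf.exists_compress {X : StarSubalgebra ℂ (Matrix α α ℂ)}
    {p : Matrix α α ℂ} (hp : IsMinProjOf X p) {x : Matrix α α ℂ} (hx : x ∈ X) :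
    ∃ c : ℂ, p * x * p = c • p := by
  obtain ⟨c, hc⟩ := hp.exists_compress_of_isHermitian (x := x + star x)
    (add_mem hx (star_mem hx)) (IsSelfAdjoint.add_star_self x)
  obtain ⟨d, hd⟩ := hp.exists_compress_of_isHermitian (x := Complex.I • (x - star x))
    (SMulMemClass.smul_mem _ (sub_mem hx (star_mem hx))) (by
      change star (Complex.I • (x - star x)) = _
      rw [star_smul, star_sub, star_star, Complex.star_def, Complex.conj_I, neg_smul, ← smul_neg,
        neg_sub])
  refine ⟨(1 / 2 : ℂ) * (c - Complex.I * d), ?_⟩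
  have hx2 : x = (1 / 2 : ℂ) • ((x + star x) - Complex.I • (Complex.I • (x - star x))) := by
    rw [smul_smul, Complex.I_mul_I, neg_one_smul, sub_neg_eq_add]
    rw [show x + star x + (x - star x) = (2 : ℂ) • x by rw [two_smul]; abel, smul_smul]
    norm_num
  conv_lhs => rw [hx2]
  rw [mul_smul_comm, smul_mul_assoc, mul_sub, sub_mul, hc, mul_smul_comm, smul_mul_assoc, hd,
    smul_smul, ← sub_smul, smul_smul]

theorem isMinProjOf_of_compress {X : StarSubalgebra ℂ (Matrix α α ℂ)} {p : Matrix α α ℂ}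
    (hpX : p ∈ X) (hp : IsProjn p) (h0 : p ≠ 0)
    (h : ∀ x ∈ X, ∃ c : ℂ, p * x * p = c • p) : IsMinProjOf X p := by
  refine ⟨hpX, hp, h0, fun q hqX hq hqp => ?_⟩
  obtain ⟨c, hc⟩ := h q hqX
  rw [hp.mul_eq_of_mul_eq hq hqp, hqp] at hc
  subst hc
  have h2 := hq.2
  rw [smul_mul_assoc, mul_smul_comm, hp.2, smul_smul] at h2
  have hcc : c * c = c := smul_left_injective ℂ h0 h2
  obtain h | h := IsIdempotentElem.iff_eq_zero_or_one.mp hcc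
  · left; simp [h]
  · right; simp [h]

/-- Elements generated by commuting subalgebras are spanned by products. -/
theorem mem_span_mul_of_mem_sup {X Y : StarSubalgebra ℂ (Matrix α α ℂ)}
    (hXY : CompatibleAlg X Y) {z : Matrix α α ℂ} (hz : z ∈ X ⊔ Y) :
    z ∈ Submodule.span ℂ {w | ∃ x ∈ X, ∃ y ∈ Y, w = x * y} := by
  change z ∈ StarAlgebra.adjoin ℂ ((X : Set (Matrix α α ℂ)) ∪ Y) at hz
  induction hz using StarAlgebra.adjoin_induction with
  | mem x hx =>
    refine Submodule.subset_span ?_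
    obtain hx | hx := hx
    · exact ⟨x, hx, 1, one_mem Y, by simp⟩
    · exact ⟨1, one_mem X, x, hx, by simp⟩
  | algebraMap c =>
    exact Submodule.subset_span ⟨algebraMap _ _ c, algebraMap_mem X c, 1, one_mem Y, by simp⟩
  | add x y _ _ hx hy => exact add_mem hx hy
  | mul x y hx' hy' hx hy =>
    clear hx' hy'
    induction hx using Submodule.span_induction with
    | mem u hu =>
      induction hy using Submodule.span_induction with
      | mem v hv =>
        obtain ⟨x₁, hx₁, y₁, hy₁, rfl⟩ := hu
        obtain ⟨x₂, hx₂, y₂, hy₂, rfl⟩ := hv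
        refine Submodule.subset_span ⟨x₁ * x₂, mul_mem hx₁ hx₂, y₁ * y₂, mul_mem hy₁ hy₂, ?_⟩
        rw [mul_assoc, ← mul_assoc y₁, ← hXY x₂ hx₂ y₁ hy₁]
        simp only [mul_assoc]
      | zero => simp
      | add v w _ _ hv hw => rw [mul_add]; exact add_mem hv hw
      | smul c v _ hv => rw [mul_smul_comm]; exact Submodule.smul_mem _ _ hv
    | zero => simp
    | add v w _ _ hv hw => rw [add_mul]; exact add_mem hv hw
    | smul c v _ hv => rw [smul_mul_assoc]; exact Submodule.smul_mem _ _ hv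
  | star x hx' hx =>
    clear hx'
    induction hx using Submodule.span_induction with
    | mem u hu =>
      obtain ⟨x₁, hx₁, y₁, hy₁, rfl⟩ := hu
      refine Submodule.subset_span ⟨star x₁, star_mem hx₁, star y₁, star_mem hy₁, ?_⟩
      rw [star_mul, hXY _ (star_mem hx₁) _ (star_mem hy₁)]
    | zero => simp
    | add v w _ _ hv hw => rw [star_add]; exact add_mem hv hw
    | smul c v _ hv => rw [star_smul]; exact Submodule.smul_mem _ _ hv

/-- The corner `e (X ⊔ Y) e` of a minimal projection `e` of `X` is `e Y`. -/
theorem IsMinProjOf.exists_corner_eq {X Y : StarSubalgebra ℂ (Matrix α α ℂ)}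
    (hXY : CompatibleAlg X Y) {e : Matrix α α ℂ} (he : IsMinProjOf X e)
    {z : Matrix α α ℂ} (hz : z ∈ X ⊔ Y) : ∃ y ∈ Y, e * z * e = e * y := by
  have hz' := mem_span_mul_of_mem_sup hXY hz
  clear hz
  induction hz' using Submodule.span_induction with
  | mem u hu =>
    obtain ⟨x, hx, y, hy, rfl⟩ := hu
    obtain ⟨c, hc⟩ := he.exists_compress hx
    refine ⟨c • y, SMulMemClass.smul_mem _ hy, ?_⟩
    rw [mul_assoc, mul_assoc, ← hXY e he.1 y hy, ← mul_assoc, ← mul_assoc, hc, smul_mul_assoc,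
      mul_smul_comm]
  | zero => exact ⟨0, zero_mem Y, by simp⟩
  | add v w _ _ hv hw =>
    obtain ⟨y, hy, h⟩ := hv
    obtain ⟨y', hy', h'⟩ := hw
    exact ⟨y + y', add_mem hy hy', by rw [mul_add, add_mul, h, h', mul_add]⟩
  | smul c v _ hv =>
    obtain ⟨y, hy, h⟩ := hv
    exact ⟨c • y, SMulMemClass.smul_mem _ hy, by rw [mul_smul_comm, smul_mul_assoc, h, mul_smul_comm]⟩

/-- A nonzero product of commuting minimal projections is minimal. -/
theorem IsMinProjOf.mul {X Y : StarSubalgebra ℂ (Matrix α α ℂ)}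
    (hXY : CompatibleAlg X Y) {e q : Matrix α α ℂ} (he : IsMinProjOf X e)
    (hq : IsMinProjOf Y q) (h0 : e * q ≠ 0) : IsMinProjOf (X ⊔ Y) (e * q) := by
  have hc := hXY e he.1 q hq.1
  refine isMinProjOf_of_compress (StarSubalgebra.mul_mem_sup he.1 hq.1) ⟨?_, ?_⟩ h0 ?_
  · change star (e * q) = e * q
    rw [star_mul, he.2.1.star_eq, hq.2.1.star_eq, hc]
  · rw [mul_assoc, ← mul_assoc q, ← hc, mul_assoc e q q, hq.2.1.2, ← mul_assoc, he.2.1.2]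
  · intro z hz
    obtain ⟨y, hy, h⟩ := he.exists_corner_eq hXY hz
    obtain ⟨c, hc'⟩ := hq.exists_compress hy
    refine ⟨c, ?_⟩
    calc e * q * z * (e * q) = q * e * z * (e * q) := by rw [hc]
      _ = q * (e * z * e) * q := by simp only [mul_assoc]
      _ = e * (q * y * q) := by rw [h, ← mul_assoc, ← hc]; simp only [mul_assoc]
      _ = c • (e * q) := by rw [hc', mul_smul_comm]

end MinProj

section CanonicalTrace

variable {α : Type*} [Fintype α] [DecidableEq α]
  {X : StarSubalgebra ℂ (Matrix α α ℂ)} {τ : Matrix α α ℂ →ₗ[ℂ] ℂ}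

theorem IsCanonicalTrace.map_sum_smul (hτ : IsCanonicalTrace X τ) {ι : Type*} [Fintype ι]
    {P : ι → Matrix α α ℂ} (hP : ∀ i, IsMinProjOf X (P i)) (c : ι → ℂ) :
    τ (∑ i, c i • P i) = ∑ i, c i := by
  rw [map_sum]
  refine Finset.sum_congr rfl fun i _ => ?_
  rw [map_smul, hτ.2.2 _ (hP i), smul_eq_mul, mul_one]

theorem IsCanonicalTrace.nonneg_of_posSemidef (hτ : IsCanonicalTrace X τ) {x : Matrix α α ℂ}
    (hx : x ∈ X) (h : x.PosSemidef) : 0 ≤ τ x := by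
  obtain ⟨ι, _, P, a, hP, hs, rfl⟩ := exists_minProj_decomposition hx h.1
  rw [hτ.map_sum_smul hP]
  refine Finset.sum_nonneg fun i _ => ?_
  exact_mod_cast hs.nonneg_of_posSemidef h i (hP i).2.2.1

theorem IsCanonicalTrace.star_of_isHermitian (hτ : IsCanonicalTrace X τ) {x : Matrix α α ℂ}
    (hx : x ∈ X) (h : x.IsHermitian) : star (τ x) = τ x := by
  obtain ⟨ι, _, P, a, hP, hs, rfl⟩ := exists_minProj_decomposition hx h
  rw [hτ.map_sum_smul hP]
  simp

theorem IsCanonicalTrace.map_star (hτ : IsCanonicalTrace X τ) {x : Matrix α α ℂ}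
    (hx : x ∈ X) : τ (star x) = star (τ x) := by
  have h1 := hτ.star_of_isHermitian (x := x + star x)
    (add_mem hx (star_mem hx)) (IsSelfAdjoint.add_star_self x)
  have h2 := hτ.star_of_isHermitian (x := Complex.I • (x - star x))
    (SMulMemClass.smul_mem _ (sub_mem hx (star_mem hx))) (by
      change star (Complex.I • (x - star x)) = _
      rw [star_smul, star_sub, star_star, Complex.star_def, Complex.conj_I, neg_smul, ← smul_neg,
        neg_sub])
  simp only [map_add, map_sub, map_smul, smul_eq_mul] at h1 h2
  apply Complex.ext
  · have := congrArg Complex.im h2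
    simp at this
    simp
    linarith
  · have := congrArg Complex.im h1
    simp at this
    simp
    linarith

theorem IsCanonicalTrace.re_star_mul_self_nonneg (hτ : IsCanonicalTrace X τ) {x : Matrix α α ℂ}
    (hx : x ∈ X) : 0 ≤ (τ (star x * x)).re :=
  (Complex.nonneg_iff.mp (hτ.2.1 x hx)).1

/-- The quadratic inequality behind Cauchy–Schwarz for `Q x P` and `Q P`. -/
theorem IsCanonicalTrace.quadratic_nonneg (hτ : IsCanonicalTrace X τ) {P Q x : Matrix α α ℂ}
    (hPX : P ∈ X) (hP : IsProjn P) (hQX : Q ∈ X) (hQ : IsProjn Q) (hx : x ∈ X) (t : ℝ) :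
    0 ≤ (τ (star (Q * x * P) * (Q * x * P))).re - 2 * t * (τ (Q * x * P)).re
      + t ^ 2 * (τ (Q * P)).re := by
  have hyX : Q * x * P ∈ X := mul_mem (mul_mem hQX hx) hPX
  have h := hτ.re_star_mul_self_nonneg
    (sub_mem hyX (SMulMemClass.smul_mem (t : ℂ) (mul_mem hQX hPX)))
  have e1 : τ (star (Q * P) * (Q * x * P)) = τ (Q * x * P) := by
    rw [star_mul, hP.star_eq, hQ.star_eq,
      show P * Q * (Q * x * P) = P * (Q * x * P) by
        rw [mul_assoc P Q, ← mul_assoc Q, ← mul_assoc Q Q, hQ.2],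
      hτ.1 _ hPX _ hyX, mul_assoc _ P P, hP.2]
  have e2 : τ (star (Q * x * P) * (Q * P)) = star (τ (Q * x * P)) := by
    rw [← e1, ← hτ.map_star (mul_mem (star_mem (mul_mem hQX hPX)) hyX), star_mul (star _),
      star_star]
  have e3 : τ (star (Q * P) * (Q * P)) = τ (Q * P) := by
    rw [star_mul, hP.star_eq, hQ.star_eq,
      show P * Q * (Q * P) = P * (Q * P) by rw [mul_assoc P Q, ← mul_assoc Q, hQ.2],
      hτ.1 _ hPX _ (mul_mem hQX hPX), mul_assoc _ P P, hP.2]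
  rw [star_sub, star_smul, sub_mul, mul_sub, mul_sub, smul_mul_assoc, smul_mul_assoc,
    mul_smul_comm, mul_smul_comm] at h
  simp only [map_sub, map_smul, e1, e2, e3, smul_eq_mul] at h
  generalize τ (star (Q * x * P) * (Q * x * P)) = g at h ⊢
  simp at h
  linarith

theorem IsCanonicalTrace.re_mul_projn_nonneg (hτ : IsCanonicalTrace X τ) {P Q : Matrix α α ℂ}
    (hPX : P ∈ X) (hP : IsProjn P) (hQX : Q ∈ X) (hQ : IsProjn Q) : 0 ≤ (τ (Q * P)).re := by
  have h := hτ.quadratic_nonneg hPX hP hQX hQ (zero_mem X) 1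
  simpa using h

variable {ι κ : Type*} [Fintype ι] [Fintype κ]

/-- A family of projections in `X` resolving the identity. -/
structure IsResolutionIn (X : StarSubalgebra ℂ (Matrix α α ℂ)) (P : ι → Matrix α α ℂ) : Prop where
  mem : ∀ i, P i ∈ X
  isOrthoSum : IsOrthoSum P 1

theorem IsCanonicalTrace.map_mul_eq_sum (hτ : IsCanonicalTrace X τ) {P : ι → Matrix α α ℂ}
    {Q : κ → Matrix α α ℂ} (hP : IsResolutionIn X P) (hQ : IsResolutionIn X Q) (a : ι → ℝ)
    {x : Matrix α α ℂ} (hx : x ∈ X) :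
    (τ ((∑ i, (a i : ℂ) • P i) * x)).re = ∑ i, ∑ j, a i * (τ (Q j * x * P i)).re := by
  rw [Finset.sum_mul, map_sum, Complex.re_sum]
  refine Finset.sum_congr rfl fun i _ => ?_
  rw [smul_mul_assoc, map_smul, smul_eq_mul, Complex.re_ofReal_mul, ← Finset.mul_sum,
    hτ.1 _ (hP.mem i) _ hx, ← Complex.re_sum, ← map_sum, ← Finset.sum_mul, ← Finset.sum_mul,
    hQ.isOrthoSum.sum_eq, one_mul]

theorem IsCanonicalTrace.map_corner (hτ : IsCanonicalTrace X τ) {P Q x : Matrix α α ℂ}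
    (hPX : P ∈ X) (hP : IsProjn P) (hQX : Q ∈ X) (hQ : IsProjn Q) (hx : x ∈ X) :
    τ (star (Q * x * P) * (Q * x * P)) = τ (P * star x * Q * x) := by
  have hu : P * star x * Q * x ∈ X := mul_mem (mul_mem (mul_mem hPX (star_mem hx)) hQX) hx
  rw [star_mul, star_mul, hP.star_eq, hQ.star_eq,
    show P * (star x * Q) * (Q * x * P) = (P * star x * Q * x) * P by
      simp only [mul_assoc]
      rw [← mul_assoc Q Q, hQ.2],
    hτ.1 _ hu _ hPX]
  simp only [← mul_assoc]
  rw [hP.2]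

theorem IsCanonicalTrace.map_mul_star_mul_self (hτ : IsCanonicalTrace X τ) {P : ι → Matrix α α ℂ}
    {Q : κ → Matrix α α ℂ} (hP : IsResolutionIn X P) (hQ : IsResolutionIn X Q) (a : ι → ℝ)
    {x : Matrix α α ℂ} (hx : x ∈ X) :
    (τ ((∑ i, (a i : ℂ) • P i) * (star x * x))).re =
      ∑ i, ∑ j, a i * (τ (star (Q j * x * P i) * (Q j * x * P i))).re := by
  rw [Finset.sum_mul, map_sum, Complex.re_sum]
  refine Finset.sum_congr rfl fun i _ => ?_
  rw [smul_mul_assoc, map_smul, smul_eq_mul, Complex.re_ofReal_mul, ← Finset.mul_sum]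
  congr 1
  rw [← Complex.re_sum]
  simp only [hτ.map_corner (hP.mem i) (hP.isOrthoSum.projn i) (hQ.mem _) (hQ.isOrthoSum.projn _) hx]
  rw [← map_sum, ← Finset.sum_mul, ← Finset.mul_sum, hQ.isOrthoSum.sum_eq, mul_one, mul_assoc]

theorem IsCanonicalTrace.map_mul_self_mul_star (hτ : IsCanonicalTrace X τ) {P : ι → Matrix α α ℂ}
    {Q : κ → Matrix α α ℂ} (hP : IsResolutionIn X P) (hQ : IsResolutionIn X Q) (b : κ → ℝ)
    {x : Matrix α α ℂ} (hx : x ∈ X) :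
    (τ ((∑ j, (b j : ℂ) • Q j) * (x * star x))).re =
      ∑ i, ∑ j, b j * (τ (star (Q j * x * P i) * (Q j * x * P i))).re := by
  rw [Finset.sum_comm, Finset.sum_mul, map_sum, Complex.re_sum]
  refine Finset.sum_congr rfl fun j _ => ?_
  rw [smul_mul_assoc, map_smul, smul_eq_mul, Complex.re_ofReal_mul, ← Finset.mul_sum]
  congr 1
  rw [← Complex.re_sum]
  simp only [hτ.map_corner (hP.mem _) (hP.isOrthoSum.projn _) (hQ.mem j) (hQ.isOrthoSum.projn j) hx]
  rw [← map_sum, ← Finset.sum_mul, ← Finset.sum_mul, ← Finset.sum_mul, hP.isOrthoSum.sum_eq,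
    one_mul, mul_assoc, hτ.1 _ (star_mem hx) _ (mul_mem (hQ.mem j) hx), mul_assoc]

/-- Upper bound in the variational formula for `∑ aᵢ² τ(Qⱼ Pᵢ) / (bⱼ + s aᵢ)`. -/
theorem IsCanonicalTrace.variational_le (hτ : IsCanonicalTrace X τ) {P : ι → Matrix α α ℂ}
    {Q : κ → Matrix α α ℂ} (hP : IsResolutionIn X P) (hQ : IsResolutionIn X Q) {a : ι → ℝ}
    {b : κ → ℝ} (ha : ∀ i, 0 ≤ a i) (hb : ∀ j, 0 ≤ b j) {s : ℝ} (hs : 0 < s)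
    {x : Matrix α α ℂ} (hx : x ∈ X) :
    2 * (τ ((∑ i, (a i : ℂ) • P i) * x)).re - ((τ ((∑ j, (b j : ℂ) • Q j) * (x * star x))).re +
      s * (τ ((∑ i, (a i : ℂ) • P i) * (star x * x))).re) ≤
    ∑ i, ∑ j, (τ (Q j * P i)).re * a i ^ 2 / (b j + s * a i) := by
  rw [hτ.map_mul_eq_sum hP hQ a hx, hτ.map_mul_self_mul_star hP hQ b hx,
    hτ.map_mul_star_mul_self hP hQ a hx]
  simp only [Finset.mul_sum, ← Finset.sum_add_distrib, ← Finset.sum_sub_distrib]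
  refine Finset.sum_le_sum fun i _ => Finset.sum_le_sum fun j _ => ?_
  have hq := hτ.quadratic_nonneg (hP.mem i) (hP.isOrthoSum.projn i) (hQ.mem j)
    (hQ.isOrthoSum.projn j) hx (a i / (b j + s * a i))
  have hg := hτ.re_star_mul_self_nonneg (mul_mem (mul_mem (hQ.mem j) hx) (hP.mem i))
  have hai := ha i
  have hbj := hb j
  generalize (τ (star (Q j * x * P i) * (Q j * x * P i))).re = g at *
  generalize (τ (Q j * x * P i)).re = h at *
  generalize (τ (Q j * P i)).re = w at *
  obtain hc | hc := (add_nonneg hbj (mul_nonneg hs.le hai)).eq_or_lt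
  · have ha0 : a i = 0 := by
      by_contra hne
      have : 0 < s * a i := mul_pos hs (lt_of_le_of_ne hai (Ne.symm hne))
      linarith
    have hb0 : b j = 0 := by rw [ha0] at hc; linarith
    simp [ha0, hb0]
  · have h2 := mul_nonneg hc.le hq
    have h3 : (b j + s * a i) * (g - 2 * (a i / (b j + s * a i)) * h +
        (a i / (b j + s * a i)) ^ 2 * w) =
        (b j + s * a i) * g - 2 * a i * h + w * a i ^ 2 / (b j + s * a i) := by
      field_simp
    rw [h3] at h2
    linarith

/-- The bound of `IsCanonicalTrace.variational_le` is attained. -/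
theorem IsCanonicalTrace.exists_variational_eq (hτ : IsCanonicalTrace X τ) {P : ι → Matrix α α ℂ}
    {Q : κ → Matrix α α ℂ} (hP : IsResolutionIn X P) (hQ : IsResolutionIn X Q) (a : ι → ℝ)
    (b : κ → ℝ) (s : ℝ) :
    ∃ x ∈ X,
    2 * (τ ((∑ i, (a i : ℂ) • P i) * x)).re - ((τ ((∑ j, (b j : ℂ) • Q j) * (x * star x))).re +
      s * (τ ((∑ i, (a i : ℂ) • P i) * (star x * x))).re) =
    ∑ i, ∑ j, (τ (Q j * P i)).re * a i ^ 2 / (b j + s * a i) := by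
  set x : Matrix α α ℂ := ∑ j, Q j * ∑ i, ((a i / (b j + s * a i) : ℝ) : ℂ) • P i with hxdef
  have hx : x ∈ X := sum_mem fun j _ => mul_mem (hQ.mem j)
    (sum_mem fun i _ => SMulMemClass.smul_mem _ (hP.mem i))
  refine ⟨x, hx, ?_⟩
  rw [hτ.map_mul_eq_sum hP hQ a hx, hτ.map_mul_self_mul_star hP hQ b hx,
    hτ.map_mul_star_mul_self hP hQ a hx]
  simp only [Finset.mul_sum, ← Finset.sum_add_distrib, ← Finset.sum_sub_distrib]
  refine Finset.sum_congr rfl fun i _ => Finset.sum_congr rfl fun j _ => ?_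
  have hy : Q j * x * P i = ((a i / (b j + s * a i) : ℝ) : ℂ) • (Q j * 1 * P i) := by
    rw [hxdef, Finset.mul_sum, Finset.sum_mul, Finset.sum_eq_single j]
    · rw [← mul_assoc, (hQ.isOrthoSum.projn j).2, mul_assoc, hP.isOrthoSum.sum_smul_mul,
        mul_smul_comm, mul_one]
    · intro k _ hk
      rw [← mul_assoc, hQ.isOrthoSum.ortho j k hk.symm, zero_mul, zero_mul]
    · simp
  have hone : τ (star (Q j * 1 * P i) * (Q j * 1 * P i)) = τ (Q j * P i) := by
    rw [hτ.map_corner (hP.mem i) (hP.isOrthoSum.projn i) (hQ.mem j) (hQ.isOrthoSum.projn j)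
      (one_mem X), star_one, mul_one, mul_one, hτ.1 _ (hP.mem i) _ (hQ.mem j)]
  rw [hy, star_smul, smul_mul_assoc, mul_smul_comm, map_smul, map_smul, map_smul, hone, mul_one]
  simp only [smul_eq_mul, Complex.star_def, Complex.conj_ofReal, Complex.re_ofReal_mul]
  by_cases hc : b j + s * a i = 0
  · simp [hc]
  · field_simp
    ring

end CanonicalTrace

section LogComparison

open Filter Topology in
/-- If `∑ mᵢ = 0` and `∑ mᵢ / (tᵢ + s) ≥ 0` for all `s > 0`, then `∑ mᵢ log tᵢ ≤ 0`. -/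
theorem sum_mul_log_nonpos {ι : Type*} [Fintype ι] {m t : ι → ℝ} (ht : ∀ i, 0 < t i)
    (hm : ∑ i, m i = 0) (h : ∀ s, 0 < s → 0 ≤ ∑ i, m i / (t i + s)) :
    ∑ i, m i * Real.log (t i) ≤ 0 := by
  have hpos : ∀ i, ∀ s : ℝ, 0 ≤ s → t i + s ≠ 0 := fun i s hs => (add_pos_of_pos_of_nonneg (ht i) hs).ne'
  set g : ℝ → ℝ := fun s => ∑ i, m i * Real.log (t i + s) with hg
  have hder : ∀ s, 0 ≤ s → HasDerivAt g (∑ i, m i / (t i + s)) s := by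
    intro s hs
    refine HasDerivAt.fun_sum fun i _ => ?_
    have := (((hasDerivAt_id s).const_add (t i)).log (hpos i s hs)).const_mul (m i)
    simpa [div_eq_mul_inv] using this
  have hmono : MonotoneOn g (Set.Ici 0) := by
    refine monotoneOn_of_deriv_nonneg (convex_Ici 0)
      (fun s hs => (hder s hs).continuousAt.continuousWithinAt)
      (fun s hs => ?_) fun s hs => ?_
    · rw [interior_Ici] at hs
      exact (hder s (le_of_lt hs)).differentiableAt.differentiableWithinAt
    · rw [interior_Ici] at hs
      rw [(hder s (le_of_lt hs)).deriv]
      exact h s hs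
  have hlim : Tendsto g atTop (𝓝 0) := by
    have h1 : Tendsto (fun s : ℝ => ∑ i, m i * Real.log (1 + t i / s)) atTop (𝓝 0) := by
      have : Tendsto (fun s : ℝ => ∑ i, m i * Real.log (1 + t i / s)) atTop
          (𝓝 (∑ i, m i * Real.log (1 + 0))) := by
        refine tendsto_finsetSum _ fun i _ => Tendsto.const_mul _ ?_
        exact (tendsto_const_nhds.add (tendsto_const_nhds.div_atTop tendsto_id)).log (by norm_num)
      simpa using this
    refine h1.congr' ?_
    filter_upwards [eventually_gt_atTop 0] with s hs
    have h2 : ∀ i, m i * Real.log (t i + s) =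
        m i * Real.log (1 + t i / s) + m i * Real.log s := by
      intro i
      rw [← mul_add, ← Real.log_mul (by have := ht i; positivity) hs.ne']
      congr 2
      field_simp
      ring
    simp only [hg, h2, Finset.sum_add_distrib, ← Finset.sum_mul, hm, zero_mul, add_zero]
  have := ge_of_tendsto hlim (b := g 0) (by
    filter_upwards [eventually_ge_atTop 0] with s hs
    exact hmono (Set.mem_Ici.mpr le_rfl) hs hs)
  simpa [hg] using this

/-- Comparison of weighted logarithms from comparison of the resolvent sums. -/
theorem sum_mul_log_sub_log_le {ι κ : Type*} [Fintype ι] [Fintype κ] {a b w : ι → ℝ}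
    {a' b' w' : κ → ℝ} (hab : ∀ i, w i * a i ≠ 0 → 0 < a i ∧ 0 < b i)
    (hab' : ∀ i, w' i * a' i ≠ 0 → 0 < a' i ∧ 0 < b' i)
    (hsum : ∑ i, w i * a i = ∑ i, w' i * a' i)
    (h : ∀ s, 0 < s → ∑ i, w' i * a' i ^ 2 / (b' i + s * a' i) ≤
      ∑ i, w i * a i ^ 2 / (b i + s * a i)) :
    ∑ i, w' i * a' i * (Real.log (a' i) - Real.log (b' i)) ≤
      ∑ i, w i * a i * (Real.log (a i) - Real.log (b i)) := by
  classical
  have key : ∀ {a b w : ℝ}, (w * a ≠ 0 → 0 < a ∧ 0 < b) →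
      0 < (if w * a = 0 then 1 else b / a) ∧
      (∀ s, 0 < s → w * a / ((if w * a = 0 then 1 else b / a) + s) = w * a ^ 2 / (b + s * a)) ∧
      w * a * Real.log (if w * a = 0 then 1 else b / a) = - (w * a * (Real.log a - Real.log b)) := by
    intro a b w hyp
    by_cases h0 : w * a = 0
    · refine ⟨by simp [h0], fun s _ => ?_, by simp [h0]⟩
      rw [pow_two, ← mul_assoc, h0]
      simp
    · obtain ⟨ha, hb⟩ := hyp h0
      simp only [h0, if_false]
      refine ⟨by positivity, fun s hs => ?_, ?_⟩
      · field_simp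
      · rw [Real.log_div hb.ne' ha.ne']
        ring
  have := sum_mul_log_nonpos
    (m := Sum.elim (fun i => w i * a i) (fun i => -(w' i * a' i)))
    (t := Sum.elim (fun i => if w i * a i = 0 then 1 else b i / a i)
      (fun i => if w' i * a' i = 0 then 1 else b' i / a' i)) ?_ ?_ ?_
  · simp only [Fintype.sum_sum_type, Sum.elim_inl, Sum.elim_inr, neg_mul, (key (hab _)).2.2,
      (key (hab' _)).2.2, Finset.sum_neg_distrib, neg_neg] at this
    linarith
  · rintro (i | i)
    exacts [(key (hab i)).1, (key (hab' i)).1]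
  · simp [hsum]
  · intro s hs
    simp only [Fintype.sum_sum_type, Sum.elim_inl, Sum.elim_inr, neg_div, (key (hab _)).2.1 s hs,
      (key (hab' _)).2.1 s hs, Finset.sum_neg_distrib]
    linarith [h s hs]

end LogComparison

section Entropy

variable {α : Type*} [Fintype α] [DecidableEq α]

theorem CompatibleAlg.sup_right {X Y Z : StarSubalgebra ℂ (Matrix α α ℂ)}
    (hY : CompatibleAlg X Y) (hZ : CompatibleAlg X Z) : CompatibleAlg X (Y ⊔ Z) := by
  intro x hx w hw
  change w ∈ StarAlgebra.adjoin ℂ ((Y : Set (Matrix α α ℂ)) ∪ Z) at hw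
  induction hw using StarAlgebra.adjoin_induction generalizing x with
  | mem w hw => exact hw.elim (hY x hx w) (hZ x hx w)
  | algebraMap c => exact (Algebra.commutes c x).symm
  | add u v _ _ hu hv => rw [mul_add, add_mul, hu x hx, hv x hx]
  | mul u v _ _ hu hv => rw [← mul_assoc, hu x hx, mul_assoc, hv x hx, mul_assoc]
  | star u _ hu =>
    have := congrArg star (hu (star x) (star_mem hx))
    rw [star_mul, star_mul, star_star] at this
    exact this.symm

/-- Cutting the canonical trace of `X ⊔ Z` by a minimal projection of `X` gives a functional on `Z`
dominated by the canonical trace. -/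
theorem IsCanonicalTrace.mul_minProj_le {X Z : StarSubalgebra ℂ (Matrix α α ℂ)}
    (hXZ : CompatibleAlg X Z) {τ τZ : Matrix α α ℂ →ₗ[ℂ] ℂ}
    (hτ : IsCanonicalTrace (X ⊔ Z) τ) (hτZ : IsCanonicalTrace Z τZ) {e z : Matrix α α ℂ}
    (he : IsMinProjOf X e) (hz : z ∈ Z) (h : z.PosSemidef) : τ (e * z) ≤ τZ z := by
  obtain ⟨ι, _, P, a, hP, hs, rfl⟩ := exists_minProj_decomposition hz h.1
  rw [hτZ.map_sum_smul hP, Finset.mul_sum, map_sum]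
  refine Finset.sum_le_sum fun i _ => ?_
  have ha : (0 : ℂ) ≤ (a i : ℂ) := by
    exact_mod_cast hs.nonneg_of_posSemidef h i (hP i).2.2.1
  rw [mul_smul_comm, map_smul, smul_eq_mul]
  by_cases h0 : e * P i = 0
  · simpa [h0] using ha
  · rw [hτ.2.2 _ (he.mul hXZ (hP i) h0), mul_one]

/-- Partial trace comparison on a product of minimal projections. -/
theorem partial_trace_le_of_minProj {X Y Z : StarSubalgebra ℂ (Matrix α α ℂ)}
    (hXZ : CompatibleAlg X Z) (hXY : CompatibleAlg X Y) (hYZ : Y ≤ Z)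
    {τ τ' τZ τY : Matrix α α ℂ →ₗ[ℂ] ℂ}
    (hτ : IsCanonicalTrace (X ⊔ Z) τ) (hτ' : IsCanonicalTrace (X ⊔ Y) τ')
    (hτZ : IsCanonicalTrace Z τZ) (hτY : IsCanonicalTrace Y τY)
    {σ σ' : Matrix α α ℂ} (hσZ : σ ∈ Z) (hσ : σ.PosSemidef) (hσY : σ' ∈ Y)
    (hrestr : ∀ y ∈ Y, τZ (σ * y) = τY (σ' * y)) {e q : Matrix α α ℂ}
    (he : IsMinProjOf X e) (hq : IsMinProjOf Y q) (h0 : e * q ≠ 0) :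
    τ (σ * (e * q)) ≤ τ' (σ' * (e * q)) := by
  have hqZ : q ∈ Z := hYZ hq.1
  have hcut : ∀ (U : StarSubalgebra ℂ (Matrix α α ℂ)) (φ : Matrix α α ℂ →ₗ[ℂ] ℂ),
      IsCanonicalTrace (X ⊔ U) φ → CompatibleAlg X U → q ∈ U → ∀ x ∈ U,
      φ (x * (e * q)) = φ (e * (q * x * q)) := by
    intro U φ hφ hXU hqU x hx
    rw [← hXU e he.1 q hqU |>.symm, ← mul_assoc]
    have h1 : φ (x * q * e) = φ (x * q * e * q) := by
      rw [mul_assoc (x * q), hXU e he.1 q hqU, ← mul_assoc, mul_assoc x q q, hq.2.1.2]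
    rw [h1, hφ.1 _ (mul_mem (mul_mem (StarSubalgebra.mem_sup_right hx)
      (StarSubalgebra.mem_sup_right hqU)) (StarSubalgebra.mem_sup_left he.1)) _
      (StarSubalgebra.mem_sup_right hqU), ← mul_assoc, ← mul_assoc q x q,
      ← hXU e he.1 _ (mul_mem (mul_mem hqU hx) hqU)]
  obtain ⟨c, hc⟩ := hq.exists_compress hσY
  have hqs : (q * σ * q).PosSemidef := by
    have := hσ.conjTranspose_mul_mul_same q
    rwa [hq.2.1.1.eq] at this
  rw [hcut Z τ hτ hXZ hqZ σ hσZ, hcut Y τ' hτ' hXY hq.1 σ' hσY, hc, mul_smul_comm, map_smul,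
    hτ'.2.2 _ (he.mul hXY hq h0)]
  refine (hτ.mul_minProj_le hXZ hτZ he (mul_mem (mul_mem hqZ hσZ) hqZ) hqs).trans_eq ?_
  rw [mul_assoc, hτZ.1 _ hqZ _ (mul_mem hσZ hqZ), mul_assoc, hq.2.1.2, hrestr q hq.1,
    ← hτY.2.2 q hq, ← map_smul τY, ← hc, mul_assoc, hτY.1 _ hq.1 _ (mul_mem hσY hq.1), mul_assoc,
    hq.2.1.2]

/-- Partial trace comparison: the density of `Z` in `X ⊔ Z`, restricted to `X ⊔ Y`, is dominated by
the density of `Y`. -/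
theorem partial_trace_le {X Y Z : StarSubalgebra ℂ (Matrix α α ℂ)}
    (hXZ : CompatibleAlg X Z) (hYZ : Y ≤ Z)
    {τ τ' τZ τY : Matrix α α ℂ →ₗ[ℂ] ℂ}
    (hτ : IsCanonicalTrace (X ⊔ Z) τ) (hτ' : IsCanonicalTrace (X ⊔ Y) τ')
    (hτZ : IsCanonicalTrace Z τZ) (hτY : IsCanonicalTrace Y τY)
    {σ σ' : Matrix α α ℂ} (hσZ : σ ∈ Z) (hσ : σ.PosSemidef) (hσY : σ' ∈ Y)
    (hrestr : ∀ y ∈ Y, τZ (σ * y) = τY (σ' * y)) {z : Matrix α α ℂ}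
    (hz : z ∈ X ⊔ Y) (hpos : z.PosSemidef) : τ (σ * z) ≤ τ' (σ' * z) := by
  have hXY : CompatibleAlg X Y := fun x hx y hy => hXZ x hx y (hYZ hy)
  obtain ⟨ι, _, E, -, hE, hEs, -⟩ :=
    exists_minProj_decomposition (X := X) (one_mem X) Matrix.isHermitian_one
  have hsum : ∀ (U : StarSubalgebra ℂ (Matrix α α ℂ)) (φ : Matrix α α ℂ →ₗ[ℂ] ℂ),
      IsCanonicalTrace (X ⊔ U) φ → CompatibleAlg X U → Y ≤ U → ∀ x ∈ U,
      φ (x * z) = ∑ i, φ (x * (E i * z * E i)) := by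
    intro U φ hφ hXU hYU x hx
    have hzU : z ∈ X ⊔ U := sup_le_sup_left hYU X hz
    have hxU : x ∈ X ⊔ U := StarSubalgebra.mem_sup_right hx
    calc φ (x * z) = ∑ i, φ (x * z * E i) := by
          rw [← map_sum, ← Finset.mul_sum, hEs.sum_eq, mul_one]
      _ = ∑ i, φ (x * (E i * z * E i)) := by
          refine Finset.sum_congr rfl fun i _ => ?_
          have hEi : E i ∈ X ⊔ U := StarSubalgebra.mem_sup_left (hE i).1
          rw [← (hE i).2.1.2, ← mul_assoc, hφ.1 _ (mul_mem (mul_mem hxU hzU) hEi) _ hEi,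
            (hE i).2.1.2]
          simp only [← mul_assoc]
          rw [hXU _ (hE i).1 x hx]
  rw [hsum Z τ hτ hXZ hYZ σ hσZ, hsum Y τ' hτ' hXY le_rfl σ' hσY]
  refine Finset.sum_le_sum fun i _ => ?_
  have he := hE i
  generalize E i = e at he
  have hze : (e * z * e).PosSemidef := by
    have := hpos.conjTranspose_mul_mul_same e
    rwa [he.2.1.1.eq] at this
  obtain ⟨y, hy, hey⟩ := he.exists_corner_eq hXY hz
  obtain ⟨w, hwY, hw, hew⟩ : ∃ w ∈ Y, w.IsHermitian ∧ e * z * e = e * w := by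
    refine ⟨(1 / 2 : ℂ) • (y + star y), SMulMemClass.smul_mem _ (add_mem hy (star_mem hy)), ?_, ?_⟩
    · change star _ = _
      rw [star_smul, star_add, star_star, add_comm]
      simp
    · have h2 : e * star y = e * z * e := by
        rw [hXY e he.1 _ (star_mem hy)]
        have := congrArg star hey
        rw [star_mul e y, he.2.1.star_eq] at this
        rw [← this]
        exact hze.1
      rw [mul_smul_comm, mul_add, ← hey, h2, ← two_smul ℂ, smul_smul]
      norm_num
  obtain ⟨κ, _, Q, b, hQ, hQs, hwQ⟩ := exists_minProj_decomposition hwY hw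
  rw [hew, hwQ]
  simp only [Finset.mul_sum, map_sum, mul_smul_comm, map_smul, smul_eq_mul]
  refine Finset.sum_le_sum fun j _ => ?_
  by_cases h0 : e * Q j = 0
  · simp [h0]
  · refine mul_le_mul_of_nonneg_left (partial_trace_le_of_minProj hXZ hXY hYZ hτ hτ' hτZ hτY hσZ hσ
      hσY hrestr he (hQ j) h0) ?_
    have hQe := hXY e he.1 _ (hQ j).1
    have h1 := hze.conjTranspose_mul_mul_same (Q j)
    rw [hew, (hQ j).2.1.1.eq, mul_assoc, mul_assoc, hwQ, hQs.sum_smul_mul, mul_smul_comm,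
      mul_smul_comm, hQe, ← mul_assoc, (hQ j).2.1.2, ← hQe] at h1
    exact nonneg_of_posSemidef_smul (he.mul hXY (hQ j) h0).2.1 h0 h1

/-- Spectral form of an algebra entropy. -/
theorem IsAlgEntropy.exists_spectral {X : StarSubalgebra ℂ (Matrix α α ℂ)} {ρ : Matrix α α ℂ}
    {H : ℝ} (h : IsAlgEntropy X ρ H) :
    ∃ (τ : Matrix α α ℂ →ₗ[ℂ] ℂ) (r : Matrix α α ℂ) (ι : Type) (_ : Fintype ι)
      (P : ι → Matrix α α ℂ) (a : ι → ℝ),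
      IsCanonicalTrace X τ ∧ IsRestriction X τ ρ r ∧ IsResolutionIn X P ∧
      r = ∑ i, (a i : ℂ) • P i ∧ (∀ i, 0 ≤ a i) ∧ (∀ i, τ (P i) = 1) ∧
      (∀ i, (ρ * P i).trace = a i) ∧ H * Real.log 2 = -∑ i, a i * Real.log (a i) := by
  obtain ⟨τ, r, hτ, hr, rfl⟩ := h
  obtain ⟨ι, _, P, a, hP, hs, hrP⟩ := exists_minProj_decomposition hr.1 hr.2.1.1
  refine ⟨τ, r, ι, inferInstance, P, a, hτ, hr, ⟨fun i => (hP i).1, hs⟩, hrP, ?_,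
    fun i => hτ.2.2 _ (hP i), ?_, ?_⟩
  · exact fun i => hs.nonneg_of_posSemidef (hrP ▸ hr.2.1) i (hP i).2.2.1
  · intro i
    rw [← hr.2.2 _ (hP i).1, hrP, hs.sum_smul_mul, map_smul, hτ.2.2 _ (hP i), smul_eq_mul, mul_one]
  · have hmul : r * matLogb r = ∑ i, ((Real.logb 2 (a i) * a i : ℝ) : ℂ) • P i := by
      rw [hrP, hs.matLogb_eq, Finset.mul_sum]
      refine Finset.sum_congr rfl fun i _ => ?_
      rw [mul_smul_comm, hs.sum_smul_mul, smul_smul, Complex.ofReal_mul]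
    rw [algEntropy, hmul, hτ.map_sum_smul hP, Complex.re_sum, neg_mul, Finset.sum_mul]
    congr 1
    refine Finset.sum_congr rfl fun i _ => ?_
    have : Real.log 2 ≠ 0 := by positivity
    rw [Complex.ofReal_re, Real.logb]
    field_simp

theorem IsResolutionIn.mono {X Y : StarSubalgebra ℂ (Matrix α α ℂ)} {ι : Type*} [Fintype ι]
    {P : ι → Matrix α α ℂ} (h : IsResolutionIn X P) (hXY : X ≤ Y) : IsResolutionIn Y P :=
  ⟨fun i => hXY (h.mem i), h.isOrthoSum⟩

/-- The entropy difference `S(b) - S(a)` as a relative entropy of the weights `τ(Qⱼ Pᵢ)`. -/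
theorem sum_overlap_mul_log {ι κ : Type*} [Fintype ι] [Fintype κ]
    {w : ι → κ → ℝ} {a : ι → ℝ} {b : κ → ℝ} (hrow : ∀ i, ∑ j, w i j = 1)
    (hcol : ∀ j, ∑ i, w i j * a i = b j) :
    ∑ ij : ι × κ, w ij.1 ij.2 * a ij.1 * (Real.log (a ij.1) - Real.log (b ij.2)) =
      ∑ i, a i * Real.log (a i) - ∑ j, b j * Real.log (b j) := by
  simp only [mul_sub, Finset.sum_sub_distrib]
  congr 1
  · rw [Fintype.sum_prod_type]
    refine Finset.sum_congr rfl fun i _ => ?_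
    simp only [mul_assoc, ← Finset.sum_mul, hrow, one_mul]
  · rw [Fintype.sum_prod_type_right]
    refine Finset.sum_congr rfl fun j _ => ?_
    simp only [← Finset.sum_mul, hcol]

theorem pos_of_overlap_ne_zero {ι κ : Type*} [Fintype ι]
    {w : ι → κ → ℝ} {a : ι → ℝ} {b : κ → ℝ} (hw : ∀ i j, 0 ≤ w i j) (ha : ∀ i, 0 ≤ a i)
    (hcol : ∀ j, ∑ i, w i j * a i = b j) (i : ι) (j : κ) (h : w i j * a i ≠ 0) :
    0 < a i ∧ 0 < b j := by
  refine ⟨lt_of_le_of_ne (ha i) fun h0 => h (by rw [← h0, mul_zero]), ?_⟩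
  rw [← hcol]
  exact (lt_of_le_of_ne (mul_nonneg (hw i j) (ha i)) h.symm).trans_le
    (Finset.single_le_sum (f := fun i => w i j * a i) (fun i _ => mul_nonneg (hw i j) (ha i))
      (Finset.mem_univ i))

/-- Marginals of the overlap weights of two restrictions of the same state. -/
theorem IsCanonicalTrace.overlap_marginals {X : StarSubalgebra ℂ (Matrix α α ℂ)}
    {τ : Matrix α α ℂ →ₗ[ℂ] ℂ} {ρ r : Matrix α α ℂ} (hτ : IsCanonicalTrace X τ)
    (hr : IsRestriction X τ ρ r) {ι κ : Type*} [Fintype ι] [Fintype κ]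
    {P : ι → Matrix α α ℂ} {Q : κ → Matrix α α ℂ}
    (hP : IsResolutionIn X P) (hQ : IsResolutionIn X Q) {a : ι → ℝ} {b : κ → ℝ}
    (hrP : r = ∑ i, (a i : ℂ) • P i) (hP1 : ∀ i, τ (P i) = 1)
    (hQb : ∀ j, (ρ * Q j).trace = b j) :
    (∀ i j, 0 ≤ (τ (Q j * P i)).re) ∧ (∀ i, ∑ j, (τ (Q j * P i)).re = 1) ∧
      ∀ j, ∑ i, (τ (Q j * P i)).re * a i = b j := by
  refine ⟨fun i j => hτ.re_mul_projn_nonneg (hP.mem i) (hP.isOrthoSum.projn i) (hQ.mem j)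
    (hQ.isOrthoSum.projn j), fun i => ?_, fun j => ?_⟩
  · rw [← Complex.re_sum, ← map_sum, ← Finset.sum_mul, hQ.isOrthoSum.sum_eq, one_mul, hP1,
      Complex.one_re]
  · have h1 : τ (r * Q j) = b j := by rw [hr.2.2 _ (hQ.mem j), hQb]
    rw [hrP, Finset.sum_mul, map_sum] at h1
    have h2 := congrArg Complex.re h1
    rw [Complex.re_sum, Complex.ofReal_re] at h2
    rw [← h2]
    refine Finset.sum_congr rfl fun i _ => ?_
    rw [smul_mul_assoc, map_smul, smul_eq_mul, Complex.re_ofReal_mul,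
      hτ.1 _ (hP.mem i) _ (hQ.mem j), mul_comm]

/-- Strong subadditivity for `X`, `Y ≤ Z` with `X` and `Z` commuting. -/
theorem strong_subadditivity {ρ : Matrix α α ℂ} {X Y Z : StarSubalgebra ℂ (Matrix α α ℂ)}
    (hXZ : CompatibleAlg X Z) (hYZ : Y ≤ Z) {HXZ HXY HZ HY : ℝ}
    (h : IsAlgEntropy (X ⊔ Z) ρ HXZ) (h' : IsAlgEntropy (X ⊔ Y) ρ HXY)
    (hZ : IsAlgEntropy Z ρ HZ) (hY : IsAlgEntropy Y ρ HY) :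
    0 ≤ HXY + HZ - HXZ - HY := by
  obtain ⟨τ, r, ι, _, P, a, hτ, hr, hP, hrP, ha, hP1, -, hH⟩ := h.exists_spectral
  obtain ⟨τ', r', ι', _, P', a', hτ', hr', hP', hrP', ha', hP1', -, hH'⟩ := h'.exists_spectral
  obtain ⟨τZ, σ, κ, _, Q, b, hτZ, hσ, hQ, hσQ, hb, -, hQb, hHZ⟩ := hZ.exists_spectral
  obtain ⟨τY, σ', κ', _, Q', b', hτY, hσ', hQ', hσQ', hb', -, hQb', hHY⟩ := hY.exists_spectral
  have hle : X ⊔ Y ≤ X ⊔ Z := sup_le_sup_left hYZ X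
  have hQX := hQ.mono (le_sup_right : Z ≤ X ⊔ Z)
  have hQX' := hQ'.mono (le_sup_right : Y ≤ X ⊔ Y)
  obtain ⟨hw, hrow, hcol⟩ := hτ.overlap_marginals hr hP hQX hrP hP1 hQb
  obtain ⟨hw', hrow', hcol'⟩ := hτ'.overlap_marginals hr' hP' hQX' hrP' hP1' hQb'
  have hrestr : ∀ y ∈ Y, τZ (σ * y) = τY (σ' * y) := fun y hy => by
    rw [hσ.2.2 y (hYZ hy), hσ'.2.2 y hy]
  have hrr : ∀ x ∈ X ⊔ Y, τ (r * x) = τ' (r' * x) := fun x hx => by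
    rw [hr.2.2 x (hle hx), hr'.2.2 x hx]
  have hmass : ∑ i, a i = ∑ i, a' i := by
    have h1 : τ (r * 1) = ((∑ i, a i : ℝ) : ℂ) := by
      rw [mul_one, hrP]
      simp [map_sum, hP1]
    have h2 : τ' (r' * 1) = ((∑ i, a' i : ℝ) : ℂ) := by
      rw [mul_one, hrP']
      simp [map_sum, hP1']
    rw [hrr 1 (one_mem _), h2] at h1
    exact_mod_cast h1.symm
  have key := sum_mul_log_sub_log_le
    (a := fun ij : ι × κ => a ij.1) (b := fun ij => b ij.2)
    (w := fun ij => (τ (Q ij.2 * P ij.1)).re)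
    (a' := fun ij : ι' × κ' => a' ij.1) (b' := fun ij => b' ij.2)
    (w' := fun ij => (τ' (Q' ij.2 * P' ij.1)).re)
    (fun ij hij => pos_of_overlap_ne_zero hw ha hcol ij.1 ij.2 hij)
    (fun ij hij => pos_of_overlap_ne_zero hw' ha' hcol' ij.1 ij.2 hij)
    (by
      simp only [Fintype.sum_prod_type, ← Finset.sum_mul, hrow, hrow', one_mul, hmass])
    (fun s hs => by
      simp only [Fintype.sum_prod_type]
      obtain ⟨x, hx, hxeq⟩ := hτ'.exists_variational_eq hP' hQX' a' b' s
      rw [← hxeq]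
      refine le_trans ?_ (hτ.variational_le hP hQX ha hb hs (hle hx))
      rw [← hrP, ← hrP', ← hσQ, ← hσQ', hrr x hx, hrr _ (mul_mem (star_mem hx) hx)]
      have := partial_trace_le hXZ hYZ hτ hτ' hτZ hτY hσ.1 hσ.2.1 hσ'.1 hrestr
        (mul_mem hx (star_mem hx)) (Matrix.posSemidef_self_mul_conjTranspose x)
      linarith [(Complex.le_def.mp this).1])
  rw [sum_overlap_mul_log (w := fun i j => (τ (Q j * P i)).re) hrow hcol,
    sum_overlap_mul_log (w := fun i j => (τ' (Q' j * P' i)).re) hrow' hcol'] at key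
  have hlog : 0 < Real.log 2 := by positivity
  refine nonneg_of_mul_nonneg_left (b := Real.log 2) ?_ hlog
  rw [sub_mul, sub_mul, add_mul, hH, hH', hHZ, hHY]
  linarith

end Entropy

/-- nonnegativity of the conditional mutual information
`I_ρ(𝔛₁∧𝔛₂|𝔜) = H_ρ(𝔛₁𝔜) + H_ρ(𝔛₂𝔜) − H_ρ(𝔛₁𝔛₂𝔜) − H_ρ(𝔜) ≥ 0`. -/
theorem conditional_mutual_information_nonneg {n : ℕ}
    (ρ : Matrix (Fin n) (Fin n) ℂ) (hρ : MatState ρ)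
    (𝔛₁ 𝔛₂ 𝔜 : StarSubalgebra ℂ (Matrix (Fin n) (Fin n) ℂ))
    (h12 : CompatibleAlg 𝔛₁ 𝔛₂) (h1Y : CompatibleAlg 𝔛₁ 𝔜)
    (h2Y : CompatibleAlg 𝔛₂ 𝔜)
    (H1Y H2Y H12Y HY : ℝ)
    (hH1Y : IsAlgEntropy (𝔛₁ ⊔ 𝔜) ρ H1Y)
    (hH2Y : IsAlgEntropy (𝔛₂ ⊔ 𝔜) ρ H2Y)
    (hH12Y : IsAlgEntropy (𝔛₁ ⊔ 𝔛₂ ⊔ 𝔜) ρ H12Y)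
    (hHY : IsAlgEntropy 𝔜 ρ HY) :
    0 ≤ H1Y + H2Y - H12Y - HY := by
  have hc := h12.sup_right h1Y
  rw [sup_assoc] at hH12Y
  exact strong_subadditivity hc le_sup_right hH12Y hH1Y hH2Y hHY
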